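/- Let R be a commutative ring and A a finitely presented R-algebra. Then for any filtered diagram (S_i) of R-algebras, the canonical map colim_i Hom_{R-alg}(A, S_i) → Hom_{R-alg}(A, colim_i S_i) is a bijection; conversely, any R-algebra A for which this map is bijective for all filtered diagrams is finitely presented. -/

import Mathlib

open CategoryTheory CategoryTheory.Limits Opposite

universe v₁ u₁ v₂ u₂

/-- An object is compact (finitely presentable) if its corepresentable functor
preserves filtered colimits. -/
def IsCompactObj {C : Type u₁} [Category.{v₁} C] (x : C) : Prop :=
  ∀ (I : Type) [SmallCategory I] [IsFiltered I],
    Nonempty (PreservesColimitsOfShape I (coyoneda.obj (op x)))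

/-- A functor preserves filtered colimits. -/
def PresFiltered {C : Type u₁} [Category.{v₁} C] {D : Type u₂} [Category.{v₂} D]
    (F : C ⥤ D) : Prop :=
  ∀ (I : Type) [SmallCategory I] [IsFiltered I], Nonempty (PreservesColimitsOfShape I F)

/-- A retract of a finitely presented algebra is finitely presented. -/
theorem Algebra.FinitePresentation.of_retract {R A B : Type*} [CommRing R] [CommRing A]
    [CommRing B] [Algebra R A] [Algebra R B] [Algebra.FinitePresentation R B]
    (q : B →ₐ[R] A) (s : A →ₐ[R] B) (h : q.comp s = AlgHom.id R A) :
    Algebra.FinitePresentation R A := by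
  classical
  have hqs (a : A) : q (s a) = a := DFunLike.congr_fun h a
  obtain ⟨S, hS⟩ := (inferInstance : Algebra.FiniteType R B).out
  refine .of_surjective (f := q) (fun a ↦ ⟨s a, hqs a⟩)
    ⟨S.image fun x ↦ x - s (q x), le_antisymm ?_ ?_⟩
  · refine Ideal.span_le.mpr fun y hy ↦ ?_
    obtain ⟨x, -, rfl⟩ := Finset.mem_image.mp hy
    simp [RingHom.mem_ker, hqs]
  · intro x hx
    set J := Ideal.span ((S.image fun x ↦ x - s (q x) : Finset B) : Set B)
    have key : Ideal.Quotient.mkₐ R J = (Ideal.Quotient.mkₐ R J).comp (s.comp q) := by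
      refine AlgHom.ext_of_adjoin_eq_top hS fun y hy ↦ ?_
      exact Ideal.Quotient.eq.mpr (Ideal.subset_span (Finset.mem_image_of_mem _ hy))
    have hx' : q x = 0 := hx
    refine Ideal.Quotient.eq_zero_iff_mem.mp ((DFunLike.congr_fun key x).trans ?_)
    simp [hx']

/-- A cocone of `R`-algebras over a filtered diagram is colimiting as soon as it is jointly
surjective and elements identified at the cocone point are identified at some stage. -/
theorem nonempty_isColimit_under {R : CommRingCat.{0}} {I : Type} [SmallCategory I] [IsFiltered I]
    {F : I ⥤ Under R} (c : Cocone F) (hsurj : ∀ x : c.pt.right, ∃ i y, (c.ι.app i).right y = x)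
    (hinj : ∀ i (x y : (F.obj i).right), (c.ι.app i).right x = (c.ι.app i).right y →
      ∃ (j : I) (f : i ⟶ j), (F.map f).right x = (F.map f).right y) :
    Nonempty (IsColimit c) := by
  have : ReflectsColimit F (Under.forget R ⋙ forget CommRingCat) :=
    reflectsColimit_of_reflectsIsomorphisms _ _
  refine ⟨isColimitOfReflects (Under.forget R ⋙ forget CommRingCat)
    (Types.FilteredColimit.isColimitOf' _ _ (fun x ↦ ?_) fun i x y h ↦ hinj i x y h)⟩
  obtain ⟨i, y, rfl⟩ := hsurj x
  exact ⟨i, y, rfl⟩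

/-- If a compact algebra is the colimit of a directed system of algebras, then it is a retract of
one of the stages. -/
theorem IsCompactObj.exists_section {R A : Type} [CommRing R] [CommRing A] [Algebra R A]
    (hA : IsCompactObj (Under.mk (CommRingCat.ofHom (algebraMap R A))))
    {I : Type} [Preorder I] [IsDirectedOrder I] [Nonempty I]
    {B : I → Type} [∀ i, CommRing (B i)] [∀ i, Algebra R (B i)]
    (f : ∀ i j, i ≤ j → B i →ₐ[R] B j) [DirectedSystem B fun i j h ↦ f i j h]
    (g : ∀ i, B i →ₐ[R] A) (hg : ∀ i j h, (g j).comp (f i j h) = g i)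
    (hsurj : ∀ a, ∃ i b, g i b = a)
    (hinj : ∀ i b b', g i b = g i b' → ∃ j h, f i j h b = f i j h b') :
    ∃ (i : I) (s : A →ₐ[R] B i), (g i).comp s = AlgHom.id R A := by
  let F : I ⥤ Under (CommRingCat.of R) :=
    { obj i := CommRingCat.mkUnder (CommRingCat.of R) (B i)
      map {i j} h := (f i j (leOfHom h)).toUnder
      map_id i := by
        ext x
        exact DirectedSystem.map_self (f := fun i j h ↦ f i j h) x
      map_comp {i j k} h h' := by
        ext x
        exact (DirectedSystem.map_map (f := fun i j h ↦ f i j h) (leOfHom h) (leOfHom h') x).symm }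
  let c : Cocone F :=
    { pt := CommRingCat.mkUnder (CommRingCat.of R) A
      ι :=
        { app i := (g i).toUnder
          naturality i j h := by
            ext x
            exact DFunLike.congr_fun (hg i j (leOfHom h)) x } }
  obtain ⟨hc⟩ := nonempty_isColimit_under c hsurj fun i x y h ↦ by
    obtain ⟨j, hij, e⟩ := hinj i x y h
    exact ⟨j, homOfLE hij, e⟩
  obtain ⟨_⟩ := hA I
  obtain ⟨i, s, hs⟩ := Types.jointly_surjective_of_isColimit
    (isColimitOfPreserves (coyoneda.obj (op (Under.mk (CommRingCat.ofHom (algebraMap R A))))) hc)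
    (𝟙 _)
  refine ⟨i, ⟨s.right.hom, fun r ↦ congr($(Under.w s).hom r)⟩, AlgHom.ext fun a ↦ ?_⟩
  exact congr($(hs).right a)

/-- A compact algebra is of finite type. -/
theorem IsCompactObj.finiteType {R A : Type} [CommRing R] [CommRing A] [Algebra R A]
    (hA : IsCompactObj (Under.mk (CommRingCat.ofHom (algebraMap R A)))) :
    Algebra.FiniteType R A := by
  classical
  let B (T : Finset A) : Subalgebra R A := Algebra.adjoin R (T : Set A)
  let f (T T' : Finset A) (h : T ≤ T') : B T →ₐ[R] B T' :=
    Subalgebra.inclusion (Algebra.adjoin_mono h)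
  have : DirectedSystem (fun T ↦ B T) fun i j h ↦ f i j h :=
    { map_self T x := DFunLike.congr_fun (Subalgebra.inclusion_self (S := B T)) x
      map_map _ _ _ _ _ x := Subalgebra.inclusion_inclusion _ _ x }
  obtain ⟨T, s, hs⟩ := hA.exists_section f (fun T ↦ (B T).val) (fun _ _ _ ↦ Subalgebra.val_comp_inclusion _)
    (fun a ↦ ⟨{a}, ⟨a, Algebra.subset_adjoin (by simp)⟩, rfl⟩)
    (fun T b b' h ↦ ⟨T, le_rfl, congrArg _ (Subtype.ext h)⟩)
  refine ⟨T, eq_top_iff.mpr fun a _ ↦ ?_⟩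
  rw [show a = s a from (DFunLike.congr_fun hs a).symm]
  exact (s a).2

/-- A compact algebra is finitely presented. -/
theorem IsCompactObj.finitePresentation {R A : Type} [CommRing R] [CommRing A] [Algebra R A]
    (hA : IsCompactObj (Under.mk (CommRingCat.ofHom (algebraMap R A)))) :
    Algebra.FinitePresentation R A := by
  classical
  obtain ⟨n, π, hπ⟩ := Algebra.FiniteType.iff_quotient_mvPolynomial''.mp hA.finiteType
  let J (T : Finset (RingHom.ker π)) : Ideal (MvPolynomial (Fin n) R) :=
    Ideal.span (Subtype.val '' (T : Set (RingHom.ker π)))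
  have hJ (T) : J T ≤ RingHom.ker π := by
    rw [Ideal.span_le]
    rintro _ ⟨x, -, rfl⟩
    exact x.2
  have hJmono {T T'} (h : T ≤ T') : J T ≤ J T' := Ideal.span_mono (Set.image_mono h)
  let f (T T') (h : T ≤ T') : (_ ⧸ J T) →ₐ[R] (_ ⧸ J T') :=
    Ideal.Quotient.factorₐ R (hJmono h)
  have : DirectedSystem (fun T ↦ _ ⧸ J T) fun i j h ↦ f i j h :=
    { map_self _ x := by
        obtain ⟨x, rfl⟩ := Ideal.Quotient.mk_surjective x
        rfl
      map_map _ _ _ _ _ x := by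
        obtain ⟨x, rfl⟩ := Ideal.Quotient.mk_surjective x
        rfl }
  obtain ⟨T, s, hs⟩ := hA.exists_section f
    (fun T ↦ Ideal.Quotient.liftₐ (J T) π fun a ha ↦ hJ T ha)
    (fun T T' h ↦ by
      refine AlgHom.ext fun x ↦ ?_
      obtain ⟨x, rfl⟩ := Ideal.Quotient.mk_surjective x
      rfl)
    (fun a ↦ by
      obtain ⟨x, rfl⟩ := hπ a
      exact ⟨∅, Ideal.Quotient.mk _ x, rfl⟩)
    (fun T b b' h ↦ by
      obtain ⟨x, rfl⟩ := Ideal.Quotient.mk_surjective b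
      obtain ⟨y, rfl⟩ := Ideal.Quotient.mk_surjective b'
      have hxy : x - y ∈ RingHom.ker π := by
        have h' : π x = π y := h
        simp [RingHom.mem_ker, h']
      refine ⟨insert ⟨x - y, hxy⟩ T, Finset.subset_insert _ _, Ideal.Quotient.eq.mpr ?_⟩
      exact Ideal.subset_span ⟨⟨x - y, hxy⟩, by simp, rfl⟩)
  have : Algebra.FinitePresentation R (MvPolynomial (Fin n) R ⧸ J T) :=
    .quotient (Submodule.fg_span (T.finite_toSet.image _))
  exact .of_retract _ s hs

/-- An R-algebra is finitely presented iff it is a compact object of the category of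
R-algebras, i.e. Hom(A, -) preserves filtered colimits. -/
theorem stmt19 (R A : Type) [CommRing R] [CommRing A] [Algebra R A] :
    Algebra.FinitePresentation R A ↔
      IsCompactObj (Under.mk (CommRingCat.ofHom (algebraMap R A))) := by
  refine ⟨fun h I _ _ ↦ ?_, fun h ↦ h.finitePresentation⟩
  have := CommRingCat.preservesFilteredColimits_coyoneda (.of R)
    (Under.mk (CommRingCat.ofHom (algebraMap R A)))
    ((RingHom.finitePresentation_algebraMap (A := R) (B := A)).mpr h)
  exact ⟨inferInstance⟩
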